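/- There exists η₀ ∈ (0,1) such that for every η ∈ (0,η₀) the following holds. Let ε ∈ (0,η), let c₁ > 0, and let (π_m)_{m≥2} be real numbers with |π_m| ≤ ε^{m−1} c₁^m for all m ≥ 2. Then there exists z ∈ (0,2) such that the series Σ_{m=2}^∞ (−1)^{m−1} π_m (z/c₁)^m converges absolutely, its sum equals 1 − z, and 1/z ≥ 1 − 3η. -/

import Mathlib

/-- Existence of the solution `z` of `1 − z = Σ_{m≥2} (−1)^{m−1} π_m (z/c₁)^m` with
absolutely convergent series and `1/z ≥ 1 − 3η`. -/
theorem renewal_fixed_point :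
    ∃ η₀ : ℝ, η₀ ∈ Set.Ioo (0 : ℝ) 1 ∧
      ∀ η ∈ Set.Ioo (0 : ℝ) η₀, ∀ ε ∈ Set.Ioo (0 : ℝ) η,
        ∀ c₁ : ℝ, 0 < c₁ → ∀ π : ℕ → ℝ,
          (∀ m : ℕ, 2 ≤ m → |π m| ≤ ε ^ (m - 1) * c₁ ^ m) →
          ∃ z : ℝ, z ∈ Set.Ioo (0 : ℝ) 2 ∧
            Summable (fun k : ℕ =>
              |(-1 : ℝ) ^ (k + 1) * π (k + 2) * (z / c₁) ^ (k + 2)|) ∧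
            (∑' k : ℕ, (-1 : ℝ) ^ (k + 1) * π (k + 2) * (z / c₁) ^ (k + 2)) = 1 - z ∧
            1 - 3 * η ≤ 1 / z := by
  refine ⟨1 / 10, by norm_num, ?_⟩
  rintro η ⟨hη0, hη1⟩ ε ⟨hε0, hε1⟩ c hc π hπ
  set b : ℝ := 1 + 2 * η with hb
  have hb0 : 0 < b := by positivity
  have hb2 : b < 12 / 10 := by rw [hb]; linarith
  have hr0 : 0 ≤ η * b := by positivity
  have hr1 : η * b < 12 / 100 := by nlinarith
  have hgeo := (hasSum_geometric_of_lt_one hr0 (by linarith)).mul_left (η * b ^ 2)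
  have hbound : ∀ k : ℕ, ∀ z ∈ Set.Icc (0 : ℝ) b,
      ‖(-1 : ℝ) ^ (k + 1) * π (k + 2) * (z / c) ^ (k + 2)‖ ≤ η * b ^ 2 * (η * b) ^ k := by
    rintro k z ⟨hz0, hzb⟩
    have h1 := hπ (k + 2) (by omega)
    have h2 : k + 2 - 1 = k + 1 := by omega
    rw [h2] at h1
    rw [norm_mul, norm_mul, norm_pow, norm_neg, norm_one, one_pow, one_mul, Real.norm_eq_abs,
      Real.norm_eq_abs, abs_of_nonneg (by positivity : 0 ≤ (z / c) ^ (k + 2))]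
    calc |π (k + 2)| * (z / c) ^ (k + 2)
        ≤ (ε ^ (k + 1) * c ^ (k + 2)) * (z / c) ^ (k + 2) := by gcongr
      _ = ε ^ (k + 1) * z ^ (k + 2) := by
        rw [div_pow]; field_simp
      _ ≤ η ^ (k + 1) * b ^ (k + 2) := by gcongr
      _ = _ := by ring
  have hcont : ContinuousOn
      (fun z : ℝ => ∑' k : ℕ, (-1 : ℝ) ^ (k + 1) * π (k + 2) * (z / c) ^ (k + 2))
      (Set.Icc 0 b) :=
    continuousOn_tsum (fun k => by fun_prop) hgeo.summable hbound
  have hg : ContinuousOn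
      (fun z : ℝ => z - 1 + ∑' k : ℕ, (-1 : ℝ) ^ (k + 1) * π (k + 2) * (z / c) ^ (k + 2))
      (Set.Icc 0 b) := by
    exact (by fun_prop : ContinuousOn (fun z : ℝ => z - 1) (Set.Icc 0 b)).add hcont
  have hS := tsum_of_norm_bounded hgeo (fun k => hbound k b ⟨hb0.le, le_rfl⟩)
  have hle : η * b ^ 2 * (1 - η * b)⁻¹ ≤ 2 * η := by
    rw [← div_eq_mul_inv, div_le_iff₀ (by linarith)]
    have : b ^ 2 ≤ 2 * (1 - η * b) := by nlinarith
    nlinarith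
  have hSb := (abs_le.mp (hS.trans hle)).1
  have hmem : (0 : ℝ) ∈ Set.Icc
      ((0 : ℝ) - 1 + ∑' k : ℕ, (-1 : ℝ) ^ (k + 1) * π (k + 2) * (0 / c) ^ (k + 2))
      (b - 1 + ∑' k : ℕ, (-1 : ℝ) ^ (k + 1) * π (k + 2) * (b / c) ^ (k + 2)) := by
    constructor
    · simp
    · linarith
  obtain ⟨z, ⟨hz0, hzb⟩, hz⟩ := intermediate_value_Icc hb0.le hg hmem
  have hzpos : 0 < z := by
    rcases hz0.eq_or_lt with h | h
    · subst h
      simp at hz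
    · exact h
  refine ⟨z, ⟨hzpos, by linarith⟩, ?_, ?_, ?_⟩
  · exact Summable.of_nonneg_of_le (fun k => abs_nonneg _)
      (fun k => hbound k z ⟨hz0, hzb⟩) hgeo.summable
  · simp only at hz
    linarith
  · rw [le_div_iff₀ hzpos]
    nlinarith
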